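/- Let f : (0,∞) → ℂ be locally absolutely continuous, of bounded variation on (0,∞), with lim_{t→∞} f(t) = 0 (so that its derivative f' is Lebesgue integrable on (0,∞)). Suppose in addition that f' ∈ H^1_Q(ℝ_+), i.e., ∫_0^∞ |f̂'_s(x)|/x dx < ∞ and the function H_0(T_{f'}) is Lebesgue integrable on (0,∞). Then for every x > 0, f̂_s(x) = (1/x) f(π/(2x)) + G(x), where ‖G‖_{L^1(0,∞)} ≤ C (‖f'‖_{L^1(0,∞)} + ‖H_0(T_{f'})‖_{L^1(0,∞)}) for an absolute constant C > 0. -/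

import Mathlib

open MeasureTheory Filter Set Real

/-- The sine integral. -/
noncomputable def sineIntegral (z : ℝ) : ℝ := ∫ s in (0 : ℝ)..z, sinc s

/-- The cosine integral, in the form obtained from `-∫_z^∞ cos s / s ds` by one integration by
parts, so that the remaining integral converges absolutely. -/
noncomputable def cosineIntegral (z : ℝ) : ℝ := sin z / z - ∫ s in Ioi z, sin s / s ^ 2

/-- The limit of the sine integral at infinity. -/
noncomputable def sineIntegralLimit : ℝ := ∫ s in Ioi (0 : ℝ), (1 - cos s) / s ^ 2

lemma hasDerivAt_sineIntegral (z : ℝ) : HasDerivAt sineIntegral (sinc z) z :=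
  intervalIntegral.integral_hasDerivAt_right (continuous_sinc.intervalIntegrable _ _)
    continuous_sinc.stronglyMeasurable.stronglyMeasurableAtFilter continuous_sinc.continuousAt

lemma continuous_sineIntegral : Continuous sineIntegral :=
  continuous_iff_continuousAt.2 fun z => (hasDerivAt_sineIntegral z).continuousAt

lemma sineIntegral_zero : sineIntegral 0 = 0 := by simp [sineIntegral]

lemma sineIntegral_neg (z : ℝ) : sineIntegral (-z) = -sineIntegral z := by
  have h := intervalIntegral.integral_comp_neg (a := 0) (b := z) sinc
  simp only [sinc_neg, neg_zero] at h
  rw [sineIntegral, sineIntegral, h, intervalIntegral.integral_symm]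

lemma abs_sineIntegral_le (z : ℝ) : |sineIntegral z| ≤ |z| := by
  have h := intervalIntegral.norm_integral_le_of_norm_le_const (a := 0) (b := z) (f := sinc) (C := 1)
    fun s _ => abs_sinc_le_one s
  simpa [sineIntegral] using h

lemma integrableOn_Ioi_const_div_sq (c : ℝ) {z : ℝ} (hz : 0 < z) :
    IntegrableOn (fun s : ℝ => c / s ^ 2) (Ioi z) := by
  refine IntegrableOn.congr_fun
    ((integrableOn_Ioi_rpow_of_lt (a := -2) (by norm_num) hz).const_mul c)
    (fun s hs => ?_) measurableSet_Ioi
  have hs : 0 < s := hz.trans hs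
  simp only [rpow_neg hs.le, div_eq_mul_inv]
  norm_num

lemma integral_Ioi_const_div_sq (c : ℝ) {z : ℝ} (hz : 0 < z) :
    ∫ s in Ioi z, c / s ^ 2 = c / z := by
  have h := integral_Ioi_rpow_of_lt (a := -2) (by norm_num) hz
  rw [setIntegral_congr_fun (g := fun s : ℝ => c * s ^ (-2 : ℝ)) measurableSet_Ioi,
    integral_const_mul, h]
  · norm_num [rpow_neg_one, div_eq_mul_inv]
  · intro s hs
    have hs : 0 < s := hz.trans hs
    simp only [rpow_neg hs.le, div_eq_mul_inv]
    norm_num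

lemma one_sub_cos_div_sq_nonneg (s : ℝ) : 0 ≤ (1 - cos s) / s ^ 2 :=
  div_nonneg (by linarith [cos_le_one s]) (sq_nonneg s)

lemma one_sub_cos_div_sq_le_one (s : ℝ) : (1 - cos s) / s ^ 2 ≤ 1 :=
  div_le_one_of_le₀ (by nlinarith [one_sub_sq_div_two_le_cos (x := s)]) (sq_nonneg s)

lemma one_sub_cos_div_sq_le (s : ℝ) : (1 - cos s) / s ^ 2 ≤ 2 / s ^ 2 := by
  gcongr
  linarith [neg_one_le_cos s]

lemma measurable_one_sub_cos_div_sq : Measurable fun s : ℝ => (1 - cos s) / s ^ 2 := by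
  fun_prop

lemma intervalIntegrable_one_sub_cos_div_sq (a b : ℝ) :
    IntervalIntegrable (fun s : ℝ => (1 - cos s) / s ^ 2) volume a b := by
  refine (intervalIntegrable_const (c := (1 : ℝ))).mono_fun
    measurable_one_sub_cos_div_sq.aestronglyMeasurable (ae_of_all _ fun s => ?_)
  dsimp only
  rw [norm_of_nonneg (one_sub_cos_div_sq_nonneg s), norm_one]
  exact one_sub_cos_div_sq_le_one s

lemma integrableOn_Ioi_one_sub_cos_div_sq {z : ℝ} (hz : 0 < z) :
    IntegrableOn (fun s : ℝ => (1 - cos s) / s ^ 2) (Ioi z) := by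
  refine (integrableOn_Ioi_const_div_sq 2 hz).mono'
    measurable_one_sub_cos_div_sq.aestronglyMeasurable (ae_of_all _ fun s => ?_)
  rw [norm_of_nonneg (one_sub_cos_div_sq_nonneg s)]
  exact one_sub_cos_div_sq_le s

lemma sineIntegralLimit_eq {z : ℝ} (hz : 0 < z) :
    sineIntegralLimit =
      (∫ s in (0 : ℝ)..z, (1 - cos s) / s ^ 2) + ∫ s in Ioi z, (1 - cos s) / s ^ 2 :=
  (intervalIntegral.integral_interval_add_Ioi' (intervalIntegrable_one_sub_cos_div_sq 0 z)
    (integrableOn_Ioi_one_sub_cos_div_sq hz)).symm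

lemma sineIntegralLimit_pos : 0 < sineIntegralLimit := by
  rw [sineIntegralLimit_eq one_pos]
  refine add_pos_of_pos_of_nonneg ?_ (integral_nonneg one_sub_cos_div_sq_nonneg)
  refine intervalIntegral.intervalIntegral_pos_of_pos_on
    (intervalIntegrable_one_sub_cos_div_sq 0 1) (fun s hs => ?_) one_pos
  have : cos s < cos 0 := cos_lt_cos_of_nonneg_of_le_pi le_rfl
    (hs.2.le.trans (by linarith [pi_gt_three])) hs.1
  rw [cos_zero] at this
  have := hs.1
  exact div_pos (by linarith) (by positivity)

lemma sineIntegral_eq {z : ℝ} (hz : 0 < z) :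
    sineIntegral z = (1 - cos z) / z + ∫ s in (0 : ℝ)..z, (1 - cos s) / s ^ 2 := by
  have hcont : ContinuousOn (fun s : ℝ => (1 - cos s) / s) (Icc 0 z) := by
    intro s hs
    rcases hs.1.eq_or_lt with rfl | hs0
    · refine ContinuousAt.continuousWithinAt ?_
      rw [ContinuousAt, div_zero]
      refine squeeze_zero_norm (a := fun s => |s|) (fun s => ?_) ?_
      · rw [norm_eq_abs, abs_div, abs_of_nonneg (by linarith [cos_le_one s] : 0 ≤ 1 - cos s)]
        refine div_le_of_le_mul₀ (abs_nonneg _) (abs_nonneg _) ?_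
        nlinarith [one_sub_sq_div_two_le_cos (x := s), abs_mul_abs_self s]
      · simpa using (continuous_abs (G := ℝ)).tendsto 0
    · exact ContinuousAt.continuousWithinAt (by fun_prop (disch := exact hs0.ne'))
  have key := intervalIntegral.integral_eq_sub_of_hasDerivAt_of_le
    (f' := fun s => sinc s - (1 - cos s) / s ^ 2) hz.le hcont (fun s hs => ?_)
    ((continuous_sinc.intervalIntegrable _ _).sub (intervalIntegrable_one_sub_cos_div_sq 0 z))
  · rw [intervalIntegral.integral_sub (continuous_sinc.intervalIntegrable _ _)
      (intervalIntegrable_one_sub_cos_div_sq 0 z), div_zero, sub_zero] at key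
    rw [sineIntegral]
    linarith
  · have hs0 : s ≠ 0 := hs.1.ne'
    refine (((hasDerivAt_cos s).const_sub 1).div (hasDerivAt_id s) hs0).congr_deriv ?_
    rw [sinc_of_ne_zero hs0]
    simp only [id]
    field_simp

lemma abs_sineIntegral_sub_limit_le {z : ℝ} (hz : 0 < z) :
    |sineIntegral z - sineIntegralLimit| ≤ 2 / z := by
  have h1 : ∫ s in Ioi z, (1 - cos s) / s ^ 2 ≤ 2 / z := by
    rw [← integral_Ioi_const_div_sq 2 hz]
    exact integral_mono (integrableOn_Ioi_one_sub_cos_div_sq hz)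
      (integrableOn_Ioi_const_div_sq 2 hz) one_sub_cos_div_sq_le
  have h2 : 0 ≤ ∫ s in Ioi z, (1 - cos s) / s ^ 2 := integral_nonneg one_sub_cos_div_sq_nonneg
  have h3 : 0 ≤ (1 - cos z) / z := div_nonneg (by linarith [cos_le_one z]) hz.le
  have h4 : (1 - cos z) / z ≤ 2 / z := by
    gcongr
    linarith [neg_one_le_cos z]
  rw [sineIntegral_eq hz, sineIntegralLimit_eq hz, abs_le]
  constructor <;> linarith

lemma tendsto_sineIntegral_atTop : Tendsto sineIntegral atTop (nhds sineIntegralLimit) := by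
  rw [tendsto_iff_norm_sub_tendsto_zero]
  refine squeeze_zero' (Eventually.of_forall fun _ => norm_nonneg _)
    ((eventually_gt_atTop 0).mono fun z hz => abs_sineIntegral_sub_limit_le hz) ?_
  exact tendsto_const_nhds.div_atTop tendsto_id

lemma abs_sineIntegral_le_limit_add_two (z : ℝ) : |sineIntegral z| ≤ sineIntegralLimit + 2 := by
  have hL := sineIntegralLimit_pos
  by_cases hz : |z| ≤ 1
  · linarith [abs_sineIntegral_le z]
  · push Not at hz
    have h0 : 0 < |z| := one_pos.trans hz
    have h1 : |sineIntegral z| = |sineIntegral (|z|)| := by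
      rcases abs_choice z with h | h <;> rw [h]
      rw [sineIntegral_neg, abs_neg]
    have h2 := abs_sineIntegral_sub_limit_le h0
    have h3 : 2 / |z| ≤ 2 := div_le_self zero_le_two hz.le
    rw [h1]
    calc |sineIntegral (|z|)| = |sineIntegral (|z|) - sineIntegralLimit + sineIntegralLimit| := by
          rw [sub_add_cancel]
      _ ≤ |sineIntegral (|z|) - sineIntegralLimit| + |sineIntegralLimit| := abs_add_le _ _
      _ ≤ sineIntegralLimit + 2 := by rw [abs_of_pos hL]; linarith

lemma integrableOn_Ioi_sin_div_sq {z : ℝ} (hz : 0 < z) :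
    IntegrableOn (fun s : ℝ => sin s / s ^ 2) (Ioi z) := by
  refine (integrableOn_Ioi_const_div_sq 1 hz).mono'
    (Measurable.aestronglyMeasurable (by fun_prop)) (ae_of_all _ fun s => ?_)
  rw [norm_eq_abs, abs_div, abs_of_nonneg (sq_nonneg s)]
  gcongr
  exact abs_sin_le_one s

lemma hasDerivAt_cosineIntegral {z : ℝ} (hz : 0 < z) :
    HasDerivAt cosineIntegral (cos z / z) z := by
  have hca : ContinuousAt (fun s : ℝ => sin s / s ^ 2) z := by
    fun_prop (disch := positivity)
  have h1 : HasDerivAt (fun y : ℝ => ∫ s in z..y, sin s / s ^ 2) (sin z / z ^ 2) z :=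
    intervalIntegral.integral_hasDerivAt_right (by simp)
      (Measurable.stronglyMeasurable (by fun_prop)).stronglyMeasurableAtFilter hca
  have h2 := ((hasDerivAt_sin z).div (hasDerivAt_id z) hz.ne').sub
    (h1.const_sub (∫ s in Ioi z, sin s / s ^ 2))
  have h3 : HasDerivAt (fun y : ℝ => sin y / y -
      ((∫ s in Ioi z, sin s / s ^ 2) - ∫ s in z..y, sin s / s ^ 2)) (cos z / z) z := by
    refine h2.congr_deriv ?_
    simp only [id]
    field_simp
    ring
  refine h3.congr_of_eventuallyEq ?_
  filter_upwards [lt_mem_nhds hz] with y hy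
  rw [cosineIntegral, ← intervalIntegral.integral_Ioi_sub_Ioi' (integrableOn_Ioi_sin_div_sq hz)
    (integrableOn_Ioi_sin_div_sq hy), sub_sub_cancel]

lemma abs_cosineIntegral_le {z : ℝ} (hz : 0 < z) : |cosineIntegral z| ≤ 2 / z := by
  have h1 : |∫ s in Ioi z, sin s / s ^ 2| ≤ 1 / z := by
    rw [← integral_Ioi_const_div_sq 1 hz, ← norm_eq_abs]
    refine norm_integral_le_of_norm_le (integrableOn_Ioi_const_div_sq 1 hz)
      (ae_of_all _ fun s => ?_)
    rw [norm_eq_abs, abs_div, abs_of_nonneg (sq_nonneg s)]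
    gcongr
    exact abs_sin_le_one s
  have h2 : |sin z / z| ≤ 1 / z := by
    rw [abs_div, abs_of_pos hz]
    gcongr
    exact abs_sin_le_one z
  have h3 : 2 / z = 1 / z + 1 / z := by ring
  rw [h3]
  exact (abs_sub _ _).trans (add_le_add h2 h1)

lemma abs_sin_le_sqrt {s : ℝ} (hs : 0 ≤ s) : |sin s| ≤ √s := by
  rcases le_total s 1 with h | h
  · refine (abs_sin_le_abs).trans ?_
    rw [abs_of_nonneg hs]
    exact le_sqrt_of_sq_le (by nlinarith)
  · exact (abs_sin_le_one s).trans (one_le_sqrt.2 h)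

lemma abs_cosineIntegral_le_rpow {z : ℝ} (hz : 0 < z) :
    |cosineIntegral z| ≤ 3 * z ^ (-1 / 2 : ℝ) := by
  have hint := integrableOn_Ioi_rpow_of_lt (a := -3 / 2) (by norm_num) hz
  have h1 : |∫ s in Ioi z, sin s / s ^ 2| ≤ 2 * z ^ (-1 / 2 : ℝ) := by
    have h := integral_Ioi_rpow_of_lt (a := -3 / 2) (by norm_num) hz
    have h' : ∫ s in Ioi z, s ^ (-3 / 2 : ℝ) = 2 * z ^ (-1 / 2 : ℝ) := by
      rw [h]; norm_num; ring
    rw [← h', ← norm_eq_abs]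
    refine norm_integral_le_of_norm_le hint ?_
    filter_upwards [ae_restrict_mem measurableSet_Ioi] with s hs
    have hs : 0 < s := hz.trans hs
    rw [norm_eq_abs, abs_div, abs_of_nonneg (sq_nonneg s), div_le_iff₀ (by positivity),
      ← rpow_natCast, ← rpow_add hs]
    norm_num
    rw [← sqrt_eq_rpow]
    exact abs_sin_le_sqrt hs.le
  have h2 : |sin z / z| ≤ z ^ (-1 / 2 : ℝ) := by
    rw [abs_div, abs_of_pos hz, div_le_iff₀ hz, ← rpow_add_one hz.ne']
    norm_num
    rw [← sqrt_eq_rpow]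
    exact abs_sin_le_sqrt hz.le
  calc |cosineIntegral z| ≤ |sin z / z| + |∫ s in Ioi z, sin s / s ^ 2| := abs_sub _ _
    _ ≤ 3 * z ^ (-1 / 2 : ℝ) := by linarith

lemma tendsto_cosineIntegral_atTop : Tendsto cosineIntegral atTop (nhds 0) := by
  refine squeeze_zero_norm' ((eventually_gt_atTop 0).mono fun z hz => abs_cosineIntegral_le hz) ?_
  exact tendsto_const_nhds.div_atTop tendsto_id

lemma measurable_cosineIntegral : Measurable cosineIntegral := by
  have h : StronglyMeasurable fun z : ℝ =>
      ∫ s, {p : ℝ × ℝ | p.1 < p.2}.indicator (fun p => sin p.2 / p.2 ^ 2) (z, s) := by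
    refine StronglyMeasurable.integral_prod_right' (Measurable.stronglyMeasurable ?_)
    exact Measurable.indicator (by fun_prop) (measurableSet_lt measurable_fst measurable_snd)
  have h' : Measurable fun z : ℝ => ∫ s in Ioi z, sin s / s ^ 2 := by
    convert h.measurable using 2 with z
    rw [← integral_indicator measurableSet_Ioi]
    rfl
  exact (measurable_sin.div measurable_id).sub h'

/-- The kernel `z ↦ cos z Si z - sin z Ci z`; `PV ∫_0^∞ sin (t u) / (t ^ 2 - x ^ 2) dt` is its
value at `u x`, divided by `x`. -/
noncomputable def hilbertSineKernel (z : ℝ) : ℝ :=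
  cos z * sineIntegral z - sin z * cosineIntegral z

/-- The integral of `t ↦ sin (t u) / (t ^ 2 - x ^ 2)` over `t > 0`, `|t - x| > δ`, in closed
form. -/
noncomputable def truncatedHilbertSineKernel (x δ u : ℝ) : ℝ :=
  (2 * hilbertSineKernel (u * x) + cos (u * x) *
      (-2 * sineIntegral (u * δ) - sineIntegral (u * (2 * x - δ)) + sineIntegral (u * (2 * x + δ)))
    + sin (u * x) * (cosineIntegral (u * (2 * x - δ)) - cosineIntegral (u * (2 * x + δ)))) / (2 * x)

lemma measurable_hilbertSineKernel : Measurable hilbertSineKernel :=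
  (measurable_cos.mul continuous_sineIntegral.measurable).sub
    (measurable_sin.mul measurable_cosineIntegral)

lemma measurable_truncatedHilbertSineKernel (x δ : ℝ) :
    Measurable (truncatedHilbertSineKernel x δ) := by
  have h1 := measurable_hilbertSineKernel
  have h2 := continuous_sineIntegral.measurable
  have h3 := measurable_cosineIntegral
  unfold truncatedHilbertSineKernel
  fun_prop

lemma abs_sin_mul_cosineIntegral_le {z v : ℝ} (hz : 0 < z) (hv : z ≤ v) :
    |sin z * cosineIntegral v| ≤ 2 := by
  rw [abs_mul]
  calc |sin z| * |cosineIntegral v| ≤ z * (2 / z) := by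
        gcongr
        · simpa [abs_of_pos hz] using abs_sin_le_abs (x := z)
        · exact (abs_cosineIntegral_le (hz.trans_le hv)).trans (by gcongr)
    _ = 2 := by field_simp

lemma abs_cos_mul_sineIntegral_le (z v : ℝ) :
    |cos z * sineIntegral v| ≤ sineIntegralLimit + 2 := by
  rw [abs_mul]
  calc |cos z| * |sineIntegral v| ≤ 1 * (sineIntegralLimit + 2) := by
        gcongr
        · exact abs_cos_le_one z
        · exact abs_sineIntegral_le_limit_add_two v
    _ = _ := one_mul _

lemma abs_truncatedHilbertSineKernel_le {x δ u : ℝ} (hx : 0 < x) (hδ : 0 < δ) (hδx : δ < x)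
    (hu : 0 < u) :
    |truncatedHilbertSineKernel x δ u| ≤ (6 * (sineIntegralLimit + 2) + 8) / (2 * x) := by
  have hz : 0 < u * x := mul_pos hu hx
  rw [truncatedHilbertSineKernel, hilbertSineKernel, abs_div, abs_of_pos (by positivity : 0 < 2 * x)]
  gcongr
  have a1 := abs_le.1 (abs_cos_mul_sineIntegral_le (u * x) (u * x))
  have a2 := abs_le.1 (abs_cos_mul_sineIntegral_le (u * x) (u * δ))
  have a3 := abs_le.1 (abs_cos_mul_sineIntegral_le (u * x) (u * (2 * x - δ)))
  have a4 := abs_le.1 (abs_cos_mul_sineIntegral_le (u * x) (u * (2 * x + δ)))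
  have b1 := abs_le.1 (abs_sin_mul_cosineIntegral_le hz le_rfl)
  have b2 := abs_le.1 (abs_sin_mul_cosineIntegral_le (v := u * (2 * x - δ)) hz
    (mul_le_mul_of_nonneg_left (by linarith) hu.le))
  have b3 := abs_le.1 (abs_sin_mul_cosineIntegral_le (v := u * (2 * x + δ)) hz
    (mul_le_mul_of_nonneg_left (by linarith) hu.le))
  rw [abs_le]
  constructor <;> linarith

lemma tendsto_truncatedHilbertSineKernel {x u : ℝ} (hx : 0 < x) (hu : 0 < u) :
    Tendsto (fun δ => truncatedHilbertSineKernel x δ u) (nhdsWithin 0 (Ioi 0))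
      (nhds (hilbertSineKernel (u * x) / x)) := by
  have hS := continuous_sineIntegral
  have h2x : (0 : ℝ) < u * (2 * x) := by positivity
  have hC := (hasDerivAt_cosineIntegral h2x).continuousAt
  have c1 : ContinuousAt (fun δ : ℝ => cosineIntegral (u * (2 * x - δ))) 0 := by
    refine ContinuousAt.comp' ?_ (by fun_prop)
    simpa using hC
  have c2 : ContinuousAt (fun δ : ℝ => cosineIntegral (u * (2 * x + δ))) 0 := by
    refine ContinuousAt.comp' ?_ (by fun_prop)
    simpa using hC
  have h : ContinuousAt (fun δ => truncatedHilbertSineKernel x δ u) 0 := by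
    unfold truncatedHilbertSineKernel
    fun_prop
  have h' : truncatedHilbertSineKernel x 0 u = hilbertSineKernel (u * x) / x := by
    simp only [truncatedHilbertSineKernel, mul_zero, sub_zero, add_zero, sineIntegral_zero]
    field_simp
    ring
  rw [← h']
  exact h.tendsto.mono_left nhdsWithin_le_nhds

lemma setOf_pos_and_lt_abs_sub {x δ : ℝ} (hδ : 0 < δ) (hδx : δ < x) :
    {t : ℝ | 0 < t ∧ δ < |t - x|} = Ioo 0 (x - δ) ∪ Ioi (x + δ) := by
  ext t
  simp only [mem_ofPred_eq, mem_union, mem_Ioo, mem_Ioi, lt_abs]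
  constructor
  · rintro ⟨h, h' | h'⟩
    · exact Or.inr (by linarith)
    · exact Or.inl ⟨h, by linarith⟩
  · rintro (⟨h, h'⟩ | h)
    · exact ⟨h, Or.inr (by linarith)⟩
    · exact ⟨by linarith, Or.inl (by linarith)⟩

lemma integrableOn_Ioi_inv_sq_sub_sq {x δ : ℝ} (hx : 0 < x) (hδ : 0 < δ) :
    IntegrableOn (fun t : ℝ => (t ^ 2 - x ^ 2)⁻¹) (Ioi (x + δ)) := by
  have hD : 0 < (x + δ) ^ 2 - x ^ 2 := by nlinarith
  refine (integrableOn_Ioi_const_div_sq ((x + δ) ^ 2 / ((x + δ) ^ 2 - x ^ 2))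
    (by positivity : 0 < x + δ)).mono'
    (Measurable.aestronglyMeasurable (by fun_prop)) ?_
  filter_upwards [ae_restrict_mem measurableSet_Ioi] with t ht
  have ht : x + δ < t := ht
  have ht2 : (x + δ) ^ 2 < t ^ 2 := by gcongr
  have hp : 0 < t ^ 2 - x ^ 2 := by linarith
  rw [norm_of_nonneg (by positivity), div_div, inv_eq_one_div, div_le_div_iff₀ hp
    (mul_pos hD (by nlinarith))]
  nlinarith [mul_nonneg (sq_nonneg x) (sub_nonneg.2 ht2.le)]

lemma integrableOn_Ioo_inv_sq_sub_sq {x δ : ℝ} (hδ : 0 < δ) :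
    IntegrableOn (fun t : ℝ => (t ^ 2 - x ^ 2)⁻¹) (Ioo 0 (x - δ)) := by
  refine (ContinuousOn.integrableOn_Icc fun t ht => ?_).mono_set Ioo_subset_Icc_self
  have : t ^ 2 - x ^ 2 ≠ 0 := by nlinarith [ht.1, ht.2]
  exact ContinuousAt.continuousWithinAt (by fun_prop (disch := exact this))

lemma integrableOn_inv_sq_sub_sq {x δ : ℝ} (hx : 0 < x) (hδ : 0 < δ) (hδx : δ < x) :
    IntegrableOn (fun t : ℝ => (t ^ 2 - x ^ 2)⁻¹) {t : ℝ | 0 < t ∧ δ < |t - x|} := by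
  rw [setOf_pos_and_lt_abs_sub hδ hδx]
  exact (integrableOn_Ioo_inv_sq_sub_sq hδ).union (integrableOn_Ioi_inv_sq_sub_sq hx hδ)

lemma integrableOn_sin_mul {h : ℝ → ℝ} {s : Set ℝ} (hh : IntegrableOn h s) (u : ℝ) :
    IntegrableOn (fun t : ℝ => sin (t * u) * h t) s :=
  Integrable.bdd_mul (c := 1) hh (Continuous.aestronglyMeasurable (by fun_prop))
    (ae_of_all _ fun _ => abs_sin_le_one _)

lemma hasDerivAt_sineIntegral_mul_sub (u c : ℝ) {t : ℝ} (ht : t - c ≠ 0) (hu : u ≠ 0) :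
    HasDerivAt (fun t => sineIntegral (u * (t - c))) (sin (u * (t - c)) / (t - c)) t := by
  refine ((hasDerivAt_sineIntegral _).comp t
    (((hasDerivAt_id t).sub_const c).const_mul u)).congr_deriv ?_
  simp only [id]
  rw [sinc_of_ne_zero (mul_ne_zero hu ht)]
  field_simp

lemma hasDerivAt_cosineIntegral_mul_sub {u c t : ℝ} (h : 0 < u * (t - c)) :
    HasDerivAt (fun t => cosineIntegral (u * (t - c))) (cos (u * (t - c)) / (t - c)) t := by
  refine ((hasDerivAt_cosineIntegral h).comp t
    (((hasDerivAt_id t).sub_const c).const_mul u)).congr_deriv ?_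
  have := left_ne_zero_of_mul h.ne'
  have := right_ne_zero_of_mul h.ne'
  field_simp

lemma sin_mul_inv_sq_sub_sq {x t : ℝ} (u : ℝ) (hx : x ≠ 0) (h1 : t - x ≠ 0) (h2 : t - -x ≠ 0) :
    (cos (u * x) * (sin (u * (t - x)) / (t - x) - sin (u * (t - -x)) / (t - -x)) +
      sin (u * x) * (cos (u * (t - x)) / (t - x) + cos (u * (t - -x)) / (t - -x))) / (2 * x) =
    sin (t * u) * (t ^ 2 - x ^ 2)⁻¹ := by
  have e1 : sin (t * u) = sin (u * (t - x)) * cos (u * x) + cos (u * (t - x)) * sin (u * x) := by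
    rw [← sin_add]; ring_nf
  have e2 : sin (t * u) =
      sin (u * (t - -x)) * cos (u * x) - cos (u * (t - -x)) * sin (u * x) := by
    rw [← sin_sub]; ring_nf
  have e3 : (cos (u * x) * (sin (u * (t - x)) / (t - x) - sin (u * (t - -x)) / (t - -x)) +
      sin (u * x) * (cos (u * (t - x)) / (t - x) + cos (u * (t - -x)) / (t - -x))) =
      (sin (u * (t - x)) * cos (u * x) + cos (u * (t - x)) * sin (u * x)) / (t - x) -
      (sin (u * (t - -x)) * cos (u * x) - cos (u * (t - -x)) * sin (u * x)) / (t - -x) := by ring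
  have e4 : t ^ 2 - x ^ 2 = (t - x) * (t - -x) := by ring
  rw [e3, ← e1, ← e2, e4]
  field_simp
  ring

lemma integral_Ioo_sin_mul_inv_sq_sub_sq {x δ u : ℝ} (hx : 0 < x) (hδ : 0 < δ) (hδx : δ < x)
    (hu : 0 < u) :
    ∫ t in Ioo 0 (x - δ), sin (t * u) * (t ^ 2 - x ^ 2)⁻¹ =
      (cos (u * x) * (-sineIntegral (u * δ) - sineIntegral (u * (2 * x - δ))) +
        sin (u * x) * (cosineIntegral (u * δ) + cosineIntegral (u * (2 * x - δ)))
        + 2 * hilbertSineKernel (u * x)) / (2 * x) := by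
  have hle : 0 ≤ x - δ := by linarith
  have key := intervalIntegral.integral_eq_sub_of_hasDerivAt (a := 0) (b := x - δ)
    (f := fun t => (cos (u * x) * (sineIntegral (u * (t - x)) - sineIntegral (u * (t - -x))) +
      sin (u * x) * (cosineIntegral (-u * (t - x)) + cosineIntegral (u * (t - -x)))) / (2 * x))
    (f' := fun t => sin (t * u) * (t ^ 2 - x ^ 2)⁻¹) (fun t ht => ?_) ?_
  · rw [← integral_Ioc_eq_integral_Ioo, ← intervalIntegral.integral_of_le hle, key,
      hilbertSineKernel]
    have r1 : u * (x - δ - x) = -(u * δ) := by ring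
    have r2 : u * (x - δ - -x) = u * (2 * x - δ) := by ring
    have r3 : -u * (x - δ - x) = u * δ := by ring
    have r4 : u * (0 - x) = -(u * x) := by ring
    have r5 : -u * (0 - x) = u * x := by ring
    have r6 : u * (0 - -x) = u * x := by ring
    rw [r1, r2, r3, r4, r5, r6, sineIntegral_neg, sineIntegral_neg]
    ring
  · rw [uIcc_of_le hle] at ht
    have h1 : t - x < 0 := by linarith [ht.2]
    have h2 : 0 < t - -x := by linarith [ht.1]
    have hpos : 0 < -u * (t - x) := by nlinarith
    refine (((((hasDerivAt_sineIntegral_mul_sub u x h1.ne hu.ne').sub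
      (hasDerivAt_sineIntegral_mul_sub u (-x) h2.ne' hu.ne')).const_mul (cos (u * x))).add
      (((hasDerivAt_cosineIntegral_mul_sub hpos).add
      (hasDerivAt_cosineIntegral_mul_sub (mul_pos hu h2))).const_mul
        (sin (u * x)))).div_const (2 * x)).congr_deriv ?_
    rw [neg_mul, cos_neg]
    exact sin_mul_inv_sq_sub_sq u hx.ne' h1.ne h2.ne'
  · rw [intervalIntegrable_iff_integrableOn_Ioo_of_le hle]
    exact integrableOn_sin_mul (integrableOn_Ioo_inv_sq_sub_sq hδ) u

lemma integral_Ioi_sin_mul_inv_sq_sub_sq {x δ u : ℝ} (hx : 0 < x) (hδ : 0 < δ) (hu : 0 < u) :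
    ∫ t in Ioi (x + δ), sin (t * u) * (t ^ 2 - x ^ 2)⁻¹ =
      -(cos (u * x) * (sineIntegral (u * δ) - sineIntegral (u * (2 * x + δ))) +
        sin (u * x) * (cosineIntegral (u * δ) + cosineIntegral (u * (2 * x + δ)))) / (2 * x) := by
  have key := integral_Ioi_of_hasDerivAt_of_tendsto' (a := x + δ) (m := 0)
    (f := fun t => (cos (u * x) * (sineIntegral (u * (t - x)) - sineIntegral (u * (t - -x))) +
      sin (u * x) * (cosineIntegral (u * (t - x)) + cosineIntegral (u * (t - -x)))) / (2 * x))
    (f' := fun t => sin (t * u) * (t ^ 2 - x ^ 2)⁻¹) (fun t ht => ?_)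
    (integrableOn_sin_mul (integrableOn_Ioi_inv_sq_sub_sq hx hδ) u) ?_
  · rw [key]
    have r1 : u * (x + δ - x) = u * δ := by ring
    have r2 : u * (x + δ - -x) = u * (2 * x + δ) := by ring
    rw [r1, r2]
    ring
  · have ht : x + δ ≤ t := ht
    have h1 : 0 < t - x := by linarith
    have h2 : 0 < t - -x := by linarith
    refine (((((hasDerivAt_sineIntegral_mul_sub u x h1.ne' hu.ne').sub
      (hasDerivAt_sineIntegral_mul_sub u (-x) h2.ne' hu.ne')).const_mul (cos (u * x))).add
      (((hasDerivAt_cosineIntegral_mul_sub (mul_pos hu h1)).add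
      (hasDerivAt_cosineIntegral_mul_sub (mul_pos hu h2))).const_mul
        (sin (u * x)))).div_const (2 * x)).congr_deriv ?_
    exact sin_mul_inv_sq_sub_sq u hx.ne' h1.ne' h2.ne'
  · have hlim (c : ℝ) : Tendsto (fun t : ℝ => u * (t - c)) atTop atTop :=
      (tendsto_atTop_add_const_right _ (-c) tendsto_id).const_mul_atTop hu
    have hS (c : ℝ) := tendsto_sineIntegral_atTop.comp (hlim c)
    have hC (c : ℝ) := tendsto_cosineIntegral_atTop.comp (hlim c)
    simpa using ((((hS x).sub (hS (-x))).const_mul (cos (u * x))).add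
      (((hC x).add (hC (-x))).const_mul (sin (u * x)))).div_const (2 * x)

lemma setIntegral_sin_mul_inv_sq_sub_sq {x δ u : ℝ} (hx : 0 < x) (hδ : 0 < δ) (hδx : δ < x)
    (hu : 0 < u) :
    ∫ t in {t : ℝ | 0 < t ∧ δ < |t - x|}, sin (t * u) * (t ^ 2 - x ^ 2)⁻¹ =
      truncatedHilbertSineKernel x δ u := by
  rw [setOf_pos_and_lt_abs_sub hδ hδx, setIntegral_union _ measurableSet_Ioi
    (integrableOn_sin_mul (integrableOn_Ioo_inv_sq_sub_sq hδ) u)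
    (integrableOn_sin_mul (integrableOn_Ioi_inv_sq_sub_sq hx hδ) u),
    integral_Ioo_sin_mul_inv_sq_sub_sq hx hδ hδx hu, integral_Ioi_sin_mul_inv_sq_sub_sq hx hδ hu,
    truncatedHilbertSineKernel]
  · ring
  · exact disjoint_left.2 fun t h1 h2 => by
      have := h1.2
      have : x + δ < t := h2
      linarith

/-- The kernel of the remainder: the kernel `cos z - 1 + 1_{z > π/2}` of
`x (f̂_s(x) - f(π/(2x))/x)`, minus the part carried by the Hilbert transform. -/
noncomputable def remainderKernel (z : ℝ) : ℝ :=
  cos z - 1 + (Ioi (π / 2)).indicator 1 z - hilbertSineKernel z / sineIntegralLimit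

lemma measurable_remainderKernel : Measurable remainderKernel :=
  ((measurable_cos.sub_const 1).add (measurable_one.indicator measurableSet_Ioi)).sub
    (measurable_hilbertSineKernel.div_const _)

lemma abs_remainderKernel_div_le_of_le {z : ℝ} (hz : 0 < z) (hz' : z ≤ π / 2) :
    |remainderKernel z / z| ≤
      1 + 1 / sineIntegralLimit + 3 / sineIntegralLimit * z ^ (-1 / 2 : ℝ) := by
  have hL := sineIntegralLimit_pos
  have h1 : |cos z - 1| ≤ z := by
    rw [abs_le]
    constructor
    · nlinarith [one_sub_sq_div_two_le_cos (x := z), pi_le_four]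
    · linarith [cos_le_one z]
  have h2 : |hilbertSineKernel z| ≤ z + z * (3 * z ^ (-1 / 2 : ℝ)) := by
    refine (abs_sub _ _).trans ?_
    rw [abs_mul, abs_mul]
    have hs : |sin z| ≤ z := by simpa [abs_of_pos hz] using abs_sin_le_abs (x := z)
    have hS : |sineIntegral z| ≤ z := by simpa [abs_of_pos hz] using abs_sineIntegral_le z
    refine add_le_add ?_ (mul_le_mul hs (abs_cosineIntegral_le_rpow hz) (abs_nonneg _) hz.le)
    calc |cos z| * |sineIntegral z| ≤ 1 * z :=
          mul_le_mul (abs_cos_le_one z) hS (abs_nonneg _) zero_le_one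
      _ = z := one_mul z
  have h3 : remainderKernel z = cos z - 1 - hilbertSineKernel z / sineIntegralLimit := by
    simp [remainderKernel, indicator_of_notMem (notMem_Ioi.2 hz')]
  rw [abs_div, abs_of_pos hz, div_le_iff₀ hz, h3]
  calc |cos z - 1 - hilbertSineKernel z / sineIntegralLimit|
      ≤ |cos z - 1| + |hilbertSineKernel z / sineIntegralLimit| := abs_sub _ _
    _ ≤ z + (z + z * (3 * z ^ (-1 / 2 : ℝ))) / sineIntegralLimit := by
        rw [abs_div, abs_of_pos hL]
        gcongr
    _ = _ := by ring

lemma abs_remainderKernel_div_le_of_lt {z : ℝ} (hz : π / 2 < z) :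
    |remainderKernel z / z| ≤ 4 / sineIntegralLimit / z ^ 2 := by
  have hL := sineIntegralLimit_pos
  have hz0 : 0 < z := pi_div_two_pos.trans hz
  have h3 : remainderKernel z = (sin z * cosineIntegral z -
      cos z * (sineIntegral z - sineIntegralLimit)) / sineIntegralLimit := by
    rw [remainderKernel, indicator_of_mem (mem_Ioi.2 hz), hilbertSineKernel, Pi.one_apply]
    field_simp
    ring
  rw [abs_div, abs_of_pos hz0, div_le_iff₀ hz0, h3, abs_div, abs_of_pos hL]
  have h4 : |sin z * cosineIntegral z| ≤ 2 / z := by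
    rw [abs_mul]
    calc |sin z| * |cosineIntegral z| ≤ 1 * (2 / z) :=
          mul_le_mul (abs_sin_le_one z) (abs_cosineIntegral_le hz0) (abs_nonneg _) zero_le_one
      _ = 2 / z := one_mul _
  have h5 : |cos z * (sineIntegral z - sineIntegralLimit)| ≤ 2 / z := by
    rw [abs_mul]
    calc |cos z| * |sineIntegral z - sineIntegralLimit| ≤ 1 * (2 / z) :=
          mul_le_mul (abs_cos_le_one z) (abs_sineIntegral_sub_limit_le hz0) (abs_nonneg _)
            zero_le_one
      _ = 2 / z := one_mul _
  calc _ ≤ (2 / z + 2 / z) / sineIntegralLimit := by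
        gcongr
        exact (abs_sub _ _).trans (add_le_add h4 h5)
    _ = _ := by field_simp; ring

lemma integrableOn_remainderKernel_div :
    IntegrableOn (fun z => remainderKernel z / z) (Ioi 0) := by
  have hm : Measurable fun z => remainderKernel z / z := measurable_remainderKernel.div measurable_id
  rw [← Ioc_union_Ioi_eq_Ioi pi_div_two_pos.le]
  refine IntegrableOn.union ?_ ?_
  · have hr : IntegrableOn (fun z : ℝ => z ^ (-1 / 2 : ℝ)) (Ioc 0 (π / 2)) :=
      (intervalIntegrable_iff_integrableOn_Ioc_of_le pi_div_two_pos.le).1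
        (intervalIntegral.intervalIntegrable_rpow' (by norm_num))
    refine Integrable.mono' (g := fun z => 1 + 1 / sineIntegralLimit +
      3 / sineIntegralLimit * z ^ (-1 / 2 : ℝ)) ?_ hm.aestronglyMeasurable ?_
    · exact (integrable_const _).add (hr.const_mul _)
    · filter_upwards [ae_restrict_mem measurableSet_Ioc] with z hz
      exact abs_remainderKernel_div_le_of_le hz.1 hz.2
  · refine (integrableOn_Ioi_const_div_sq (4 / sineIntegralLimit) pi_div_two_pos).mono'
      hm.aestronglyMeasurable ?_
    filter_upwards [ae_restrict_mem measurableSet_Ioi] with z hz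
    exact abs_remainderKernel_div_le_of_lt hz

/-- The Mellin-type convolution `x ↦ ∫ g(u) k(u x) / x du`. -/
lemma integrable_mellin_convolution {g : ℝ → ℂ} (hg : IntegrableOn g (Ioi 0)) {k : ℝ → ℝ}
    (hk : Measurable k) (hki : IntegrableOn (fun z => k z / z) (Ioi 0)) :
    Integrable (fun p : ℝ × ℝ => g p.2 * ((k (p.2 * p.1) / p.1 : ℝ) : ℂ))
        ((volume.restrict (Ioi 0)).prod (volume.restrict (Ioi 0))) ∧
      ∀ u ∈ Ioi (0 : ℝ), ∫ x in Ioi (0 : ℝ), ‖g u * ((k (u * x) / x : ℝ) : ℂ)‖ =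
        ‖g u‖ * ∫ z in Ioi (0 : ℝ), |k z / z| := by
  have hfun {u : ℝ} (hu : 0 < u) (x : ℝ) : k (u * x) / x = u * (k (u * x) / (u * x)) := by
    rcases eq_or_ne x 0 with rfl | hx
    · simp
    · field_simp
  have hval : ∀ u ∈ Ioi (0 : ℝ), ∫ x in Ioi (0 : ℝ), ‖g u * ((k (u * x) / x : ℝ) : ℂ)‖ =
        ‖g u‖ * ∫ z in Ioi (0 : ℝ), |k z / z| := by
    intro u hu
    have hu : 0 < u := hu
    simp only [norm_mul, Complex.norm_real, norm_eq_abs]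
    rw [integral_const_mul]
    congr 1
    have := integral_comp_mul_left_Ioi (fun z => |k z / z|) 0 hu
    rw [mul_zero, smul_eq_mul] at this
    have habs (x : ℝ) : |k (u * x) / x| = u * |k (u * x) / (u * x)| := by
      rw [hfun hu, abs_mul, abs_of_pos hu]
    rw [integral_congr_ae (ae_of_all _ habs), integral_const_mul, this,
      mul_inv_cancel_left₀ hu.ne']
  refine ⟨?_, hval⟩
  have hmeas : AEStronglyMeasurable (fun p : ℝ × ℝ => g p.2 * ((k (p.2 * p.1) / p.1 : ℝ) : ℂ))
      ((volume.restrict (Ioi 0)).prod (volume.restrict (Ioi 0))) := by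
    refine AEStronglyMeasurable.mul hg.aestronglyMeasurable.comp_snd ?_
    exact Measurable.aestronglyMeasurable (by fun_prop)
  rw [integrable_prod_iff' hmeas]
  constructor
  · filter_upwards [ae_restrict_mem measurableSet_Ioi] with u hu
    have hu : 0 < u := hu
    refine Integrable.const_mul (Integrable.ofReal ?_) _
    have := (integrableOn_Ioi_comp_mul_left_iff (fun z => k z / z) 0 hu).2
    rw [mul_zero] at this
    exact ((this hki).const_mul u).congr (ae_of_all _ fun x => (hfun hu x).symm)
  · refine Integrable.congr (f := fun u => ‖g u‖ * ∫ z in Ioi (0 : ℝ), |k z / z|)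
      (hg.norm.mul_const _) ?_
    filter_upwards [ae_restrict_mem measurableSet_Ioi] with u hu
    exact (hval u hu).symm

lemma integral_norm_mellin_convolution_le {g : ℝ → ℂ} (hg : IntegrableOn g (Ioi 0)) {k : ℝ → ℝ}
    (hk : Measurable k) (hki : IntegrableOn (fun z => k z / z) (Ioi 0)) :
    ∫ x in Ioi (0 : ℝ), ‖∫ u in Ioi (0 : ℝ), g u * ((k (u * x) / x : ℝ) : ℂ)‖ ≤
      (∫ z in Ioi (0 : ℝ), |k z / z|) * ∫ u in Ioi (0 : ℝ), ‖g u‖ := by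
  obtain ⟨hint, hval⟩ := integrable_mellin_convolution hg hk hki
  calc _ ≤ ∫ x in Ioi (0 : ℝ), ∫ u in Ioi (0 : ℝ), ‖g u * ((k (u * x) / x : ℝ) : ℂ)‖ :=
        integral_mono hint.integral_prod_left.norm hint.norm.integral_prod_left
          fun x => norm_integral_le_integral_norm _
    _ = ∫ u in Ioi (0 : ℝ), ∫ x in Ioi (0 : ℝ), ‖g u * ((k (u * x) / x : ℝ) : ℂ)‖ :=
        integral_integral_swap hint.norm
    _ = ∫ u in Ioi (0 : ℝ), ‖g u‖ * ∫ z in Ioi (0 : ℝ), |k z / z| :=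
        setIntegral_congr_fun measurableSet_Ioi hval
    _ = _ := by rw [integral_mul_const, mul_comm]

lemma integrableOn_mul_ofReal_of_abs_le {g : ℝ → ℂ} {s : Set ℝ} (hg : IntegrableOn g s)
    {k : ℝ → ℝ} (hk : Measurable k) {c : ℝ} (hs : MeasurableSet s) (hc : ∀ u ∈ s, |k u| ≤ c) :
    IntegrableOn (fun u => g u * (k u : ℂ)) s := by
  refine Integrable.mul_bdd (c := c) hg (Measurable.aestronglyMeasurable (by fun_prop)) ?_
  filter_upwards [ae_restrict_mem hs] with u hu
  simpa using hc u hu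

lemma setIntegral_sineTransform_div {g : ℝ → ℂ} (hg : IntegrableOn g (Ioi 0)) {x δ : ℝ}
    (hx : 0 < x) (hδ : 0 < δ) (hδx : δ < x) :
    ∫ t in {t : ℝ | 0 < t ∧ δ < |t - x|},
        (t : ℂ) * ((∫ u in Ioi (0 : ℝ), g u * (sin (t * u) : ℂ)) / (t : ℂ)) /
          ((t : ℂ) ^ 2 - (x : ℂ) ^ 2) =
      ∫ u in Ioi (0 : ℝ), g u * (truncatedHilbertSineKernel x δ u : ℂ) := by
  have hS : MeasurableSet {t : ℝ | 0 < t ∧ δ < |t - x|} := by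
    rw [setOf_pos_and_lt_abs_sub hδ hδx]
    exact measurableSet_Ioo.union measurableSet_Ioi
  have hint : Integrable (fun p : ℝ × ℝ => g p.2 * ((sin (p.1 * p.2) * (p.1 ^ 2 - x ^ 2)⁻¹ : ℝ) : ℂ))
      ((volume.restrict {t : ℝ | 0 < t ∧ δ < |t - x|}).prod (volume.restrict (Ioi 0))) := by
    have h1 := Integrable.mul_prod
      (Integrable.ofReal (𝕜 := ℂ) (integrableOn_inv_sq_sub_sq hx hδ hδx)) hg
    refine (h1.bdd_mul (c := 1) (f := fun p : ℝ × ℝ => ((sin (p.1 * p.2) : ℝ) : ℂ))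
      (Continuous.aestronglyMeasurable (by fun_prop)) (ae_of_all _ fun p => ?_)).congr
      (ae_of_all _ fun p => ?_)
    · rw [Complex.norm_real]
      exact abs_sin_le_one _
    · simp only [RCLike.ofReal_eq_complex_ofReal]
      push_cast
      ring
  calc _ = ∫ t in {t : ℝ | 0 < t ∧ δ < |t - x|}, ∫ u in Ioi (0 : ℝ),
        g u * ((sin (t * u) * (t ^ 2 - x ^ 2)⁻¹ : ℝ) : ℂ) := by
        refine setIntegral_congr_fun hS fun t ht => ?_
        have ht0 : (t : ℂ) ≠ 0 := Complex.ofReal_ne_zero.2 ht.1.ne'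
        rw [mul_div_cancel₀ _ ht0, div_eq_mul_inv, ← integral_mul_const]
        push_cast
        simp only [mul_assoc]
    _ = ∫ u in Ioi (0 : ℝ), ∫ t in {t : ℝ | 0 < t ∧ δ < |t - x|},
        g u * ((sin (t * u) * (t ^ 2 - x ^ 2)⁻¹ : ℝ) : ℂ) := integral_integral_swap hint
    _ = _ := by
        refine setIntegral_congr_fun measurableSet_Ioi fun u hu => ?_
        rw [integral_const_mul, integral_complex_ofReal,
          setIntegral_sin_mul_inv_sq_sub_sq hx hδ hδx hu]

lemma tendsto_truncated_hilbert_transform {g : ℝ → ℂ} (hg : IntegrableOn g (Ioi 0)) {x : ℝ}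
    (hx : 0 < x) :
    Tendsto (fun δ : ℝ => ∫ t in {t : ℝ | 0 < t ∧ δ < |t - x|},
        (t : ℂ) * ((∫ u in Ioi (0 : ℝ), g u * (sin (t * u) : ℂ)) / (t : ℂ)) /
          ((t : ℂ) ^ 2 - (x : ℂ) ^ 2)) (nhdsWithin 0 (Ioi 0))
      (nhds (∫ u in Ioi (0 : ℝ), g u * ((hilbertSineKernel (u * x) / x : ℝ) : ℂ))) := by
  have hev : ∀ᶠ δ in nhdsWithin (0 : ℝ) (Ioi 0), 0 < δ ∧ δ < x :=
    Ioo_mem_nhdsGT hx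
  have h : Tendsto (fun δ : ℝ => ∫ u in Ioi (0 : ℝ), g u * (truncatedHilbertSineKernel x δ u : ℂ))
      (nhdsWithin 0 (Ioi 0))
      (nhds (∫ u in Ioi (0 : ℝ), g u * ((hilbertSineKernel (u * x) / x : ℝ) : ℂ))) := by
    refine tendsto_integral_filter_of_dominated_convergence
      (fun u => ‖g u‖ * ((6 * (sineIntegralLimit + 2) + 8) / (2 * x))) ?_ ?_
      (hg.norm.mul_const _) ?_
    · refine Eventually.of_forall fun δ => hg.aestronglyMeasurable.mul ?_
      have := measurable_truncatedHilbertSineKernel x δ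
      exact Measurable.aestronglyMeasurable (by fun_prop)
    · filter_upwards [hev] with δ hδ
      filter_upwards [ae_restrict_mem measurableSet_Ioi] with u hu
      rw [norm_mul, Complex.norm_real]
      gcongr
      exact abs_truncatedHilbertSineKernel_le hx hδ.1 hδ.2 hu
    · filter_upwards [ae_restrict_mem measurableSet_Ioi] with u hu
      exact ((Complex.continuous_ofReal.tendsto _).comp
        (tendsto_truncatedHilbertSineKernel hx hu)).const_mul (g u)
  refine h.congr' ?_
  filter_upwards [hev] with δ hδ
  exact (setIntegral_sineTransform_div hg hx hδ.1 hδ.2).symm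

lemma eq_neg_integral_Ioi_of_tendsto_zero {f g : ℝ → ℂ}
    (hf : ∀ a b : ℝ, 0 < a → a ≤ b → f b - f a = ∫ t in a..b, g t)
    (hlim : Tendsto f atTop (nhds 0)) (hg : IntegrableOn g (Ioi 0)) {t : ℝ} (ht : 0 < t) :
    f t = -∫ s in Ioi t, g s := by
  have h1 := intervalIntegral_tendsto_integral_Ioi t (hg.mono_set (Ioi_subset_Ioi ht.le)) tendsto_id
  have h2 : Tendsto (fun b => f b - f t) atTop (nhds (0 - f t)) := hlim.sub_const _
  have h3 : Tendsto (fun b => f b - f t) atTop (nhds (∫ s in Ioi t, g s)) := by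
    refine h1.congr' ?_
    filter_upwards [eventually_ge_atTop t] with b hb
    exact (hf t b ht hb).symm
  rw [tendsto_nhds_unique h3 h2]
  ring

lemma integral_mul_sin_eq {f g : ℝ → ℂ} (hfg : ∀ t, 0 < t → f t = -∫ s in Ioi t, g s)
    (hg : IntegrableOn g (Ioi 0)) {x N : ℝ} (hx : 0 < x) (hN : 0 ≤ N) :
    ∫ t in (0 : ℝ)..N, f t * (sin (x * t) : ℂ) =
      ∫ s in Ioi (0 : ℝ), g s * (((cos (x * min s N) - 1) / x : ℝ) : ℂ) := by
  have hint : Integrable (fun p : ℝ × ℝ => {p : ℝ × ℝ | p.1 < p.2}.indicator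
      (fun p => g p.2 * ((-sin (x * p.1) : ℝ) : ℂ)) p)
      ((volume.restrict (Ioc 0 N)).prod (volume.restrict (Ioi 0))) := by
    refine Integrable.indicator ?_ (measurableSet_lt measurable_fst measurable_snd)
    have h1 : Integrable (fun t : ℝ => ((-sin (x * t) : ℝ) : ℂ)) (volume.restrict (Ioc 0 N)) :=
      (Continuous.integrableOn_Ioc (by fun_prop))
    refine (h1.mul_prod hg).congr (ae_of_all _ fun p => ?_)
    exact mul_comm _ _
  rw [intervalIntegral.integral_of_le hN]
  calc _ = ∫ t in Ioc 0 N, ∫ s in Ioi (0 : ℝ), {p : ℝ × ℝ | p.1 < p.2}.indicator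
          (fun p => g p.2 * ((-sin (x * p.1) : ℝ) : ℂ)) (t, s) := by
        refine setIntegral_congr_fun measurableSet_Ioc fun t ht => ?_
        have e (s : ℝ) : {p : ℝ × ℝ | p.1 < p.2}.indicator
            (fun p => g p.2 * ((-sin (x * p.1) : ℝ) : ℂ)) (t, s) =
            (Ioi t).indicator (fun s => g s * ((-sin (x * t) : ℝ) : ℂ)) s := rfl
        simp only [e]
        rw [setIntegral_indicator measurableSet_Ioi, Ioi_inter_Ioi, sup_of_le_right ht.1.le,
          integral_mul_const, hfg t ht.1]
        push_cast
        ring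
    _ = ∫ s in Ioi (0 : ℝ), ∫ t in Ioc 0 N, {p : ℝ × ℝ | p.1 < p.2}.indicator
          (fun p => g p.2 * ((-sin (x * p.1) : ℝ) : ℂ)) (t, s) := integral_integral_swap hint
    _ = _ := by
        refine setIntegral_congr_fun measurableSet_Ioi fun s hs => ?_
        have hs : 0 < s := hs
        have e (t : ℝ) : {p : ℝ × ℝ | p.1 < p.2}.indicator
            (fun p => g p.2 * ((-sin (x * p.1) : ℝ) : ℂ)) (t, s) =
            (Iio s).indicator (fun t => g s * ((-sin (x * t) : ℝ) : ℂ)) t := rfl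
        simp only [e]
        rw [setIntegral_indicator measurableSet_Iio, integral_const_mul, integral_complex_ofReal]
        congr 2
        have hset : (Ioc 0 N ∩ Iio s : Set ℝ) =ᵐ[volume] Ioc 0 (min s N) := by
          rw [min_comm, ← Ioc_inter_Iic]
          exact (ae_eq_refl _).inter Iio_ae_eq_Iic
        rw [setIntegral_congr_set hset, ← intervalIntegral.integral_of_le (le_min hs.le hN),
          intervalIntegral.integral_neg, intervalIntegral.integral_comp_mul_left _ hx.ne',
          integral_sin]
        simp only [mul_zero, cos_zero, smul_eq_mul]
        field_simp
        ring

lemma sine_transform_eq {f g : ℝ → ℂ} (hfg : ∀ t, 0 < t → f t = -∫ s in Ioi t, g s)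
    (hg : IntegrableOn g (Ioi 0)) {x : ℝ} (hx : 0 < x) {F : ℂ}
    (hF : Tendsto (fun N : ℝ => ∫ t in (0 : ℝ)..N, f t * (sin (x * t) : ℂ)) atTop (nhds F)) :
    F = ∫ s in Ioi (0 : ℝ), g s * (((cos (s * x) - 1) / x : ℝ) : ℂ) := by
  refine tendsto_nhds_unique hF ?_
  have h : Tendsto (fun N : ℝ => ∫ s in Ioi (0 : ℝ), g s * (((cos (x * min s N) - 1) / x : ℝ) : ℂ))
      atTop (nhds (∫ s in Ioi (0 : ℝ), g s * (((cos (s * x) - 1) / x : ℝ) : ℂ))) := by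
    refine tendsto_integral_filter_of_dominated_convergence
      (fun s => ‖g s‖ * (2 / x)) ?_ ?_ (hg.norm.mul_const _) ?_
    · exact Eventually.of_forall fun N => hg.aestronglyMeasurable.mul
        (Continuous.aestronglyMeasurable (by fun_prop))
    · refine Eventually.of_forall fun N => ae_of_all _ fun s => ?_
      rw [norm_mul, Complex.norm_real, norm_eq_abs, abs_div, abs_of_pos hx]
      gcongr
      rw [abs_le]
      constructor <;> linarith [cos_le_one (x * min s N), neg_one_le_cos (x * min s N)]
    · refine ae_of_all _ fun s => tendsto_const_nhds.congr' ?_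
      filter_upwards [eventually_ge_atTop s] with N hN
      rw [min_eq_left hN, mul_comm x s]
  refine h.congr' ?_
  filter_upwards [eventually_ge_atTop 0] with N hN
  exact (integral_mul_sin_eq hfg hg hx hN).symm

lemma integral_remainderKernel_eq {g : ℝ → ℂ} (hg : IntegrableOn g (Ioi 0)) {x : ℝ} (hx : 0 < x) :
    ∫ u in Ioi (0 : ℝ), g u * ((remainderKernel (u * x) / x : ℝ) : ℂ) =
      (∫ u in Ioi (0 : ℝ), g u * (((cos (u * x) - 1) / x : ℝ) : ℂ)) +
        ((1 / x : ℝ) : ℂ) * (∫ u in Ioi (π / (2 * x)), g u) -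
        ((1 / sineIntegralLimit : ℝ) : ℂ) *
          ∫ u in Ioi (0 : ℝ), g u * ((hilbertSineKernel (u * x) / x : ℝ) : ℂ) := by
  have i1 : IntegrableOn (fun u => g u * (((cos (u * x) - 1) / x : ℝ) : ℂ)) (Ioi 0) := by
    refine integrableOn_mul_ofReal_of_abs_le hg (c := 2 / x) (by fun_prop) measurableSet_Ioi
      fun u _ => ?_
    rw [abs_div, abs_of_pos hx]
    gcongr
    rw [abs_le]
    constructor <;> linarith [cos_le_one (u * x), neg_one_le_cos (u * x)]
  have i2 : IntegrableOn (fun u => g u * ((hilbertSineKernel (u * x) / x : ℝ) : ℂ)) (Ioi 0) := by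
    have := measurable_hilbertSineKernel
    refine integrableOn_mul_ofReal_of_abs_le hg (c := (sineIntegralLimit + 2 + 2) / x)
      (by fun_prop) measurableSet_Ioi fun u hu => ?_
    rw [abs_div, abs_of_pos hx]
    gcongr
    exact (abs_sub _ _).trans (add_le_add (abs_cos_mul_sineIntegral_le _ _)
      (abs_sin_mul_cosineIntegral_le (mul_pos hu hx) le_rfl))
  have hpos : 0 < π / (2 * x) := by positivity
  have i3 : IntegrableOn ((Ioi (π / (2 * x))).indicator g) (Ioi 0) :=
    Integrable.indicator hg measurableSet_Ioi
  have e3 : ∫ u in Ioi (π / (2 * x)), g u =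
      ∫ u in Ioi (0 : ℝ), (Ioi (π / (2 * x))).indicator g u := by
    rw [setIntegral_indicator measurableSet_Ioi, Ioi_inter_Ioi, sup_of_le_right hpos.le]
  have i13 : IntegrableOn (fun u => g u * (((cos (u * x) - 1) / x : ℝ) : ℂ) +
      ((1 / x : ℝ) : ℂ) * (Ioi (π / (2 * x))).indicator g u) (Ioi 0) := i1.add (i3.const_mul _)
  rw [e3, ← integral_const_mul, ← integral_const_mul, ← integral_add i1 (i3.const_mul _),
    ← integral_sub i13 (i2.const_mul _)]
  refine setIntegral_congr_fun measurableSet_Ioi fun u _ => ?_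
  have hiff : u ∈ Ioi (π / (2 * x)) ↔ u * x ∈ Ioi (π / 2) := by
    rw [mem_Ioi, mem_Ioi, div_lt_iff₀ (by positivity), div_lt_iff₀ two_pos]
    ring_nf
  rw [remainderKernel]
  by_cases h : u * x ∈ Ioi (π / 2)
  · rw [indicator_of_mem h, indicator_of_mem (hiff.2 h)]
    simp only [Pi.one_apply]
    push_cast
    ring
  · rw [indicator_of_notMem h, indicator_of_notMem (mt hiff.1 h)]
    push_cast
    ring

/-- **Corollary.** If `f : (0,∞) → ℂ` is locally absolutely continuous (with derivative
`f'`), of bounded variation, tends to `0` at infinity (so `f'` is integrable on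
`(0,∞)`), and `f' ∈ H¹_Q(ℝ₊)`, i.e. `∫_0^∞ |f̂'_s(x)|/x dx < ∞` and `H₀(T_{f'})` is
Lebesgue integrable on `(0,∞)`, then for every `x > 0`,
`f̂_s(x) = (1/x) f(π/(2x)) + G(x)` with
`‖G‖_{L¹(0,∞)} ≤ C (‖f'‖_{L¹(0,∞)} + ‖H₀(T_{f'})‖_{L¹(0,∞)})` for an absolute
constant `C > 0`. -/
theorem sine_fourier_transform_asymptotics_of_H1Q :
    ∃ C : ℝ, 0 < C ∧
      ∀ (f f' fs H0T : ℝ → ℂ),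
        -- local absolute continuity on (0,∞) with derivative f'
        (∀ a b : ℝ, 0 < a → a ≤ b → f b - f a = ∫ t in a..b, f' t) →
        -- bounded variation on (0,∞)
        BoundedVariationOn f (Set.Ioi 0) →
        -- vanishing at infinity
        Filter.Tendsto f Filter.atTop (nhds 0) →
        -- f' is Lebesgue integrable on (0,∞)
        MeasureTheory.IntegrableOn f' (Set.Ioi 0) →
        -- fs is the (improper) sine Fourier transform of f
        (∀ x : ℝ, 0 < x →
          Filter.Tendsto (fun N : ℝ => ∫ t in (0 : ℝ)..N, f t * (Real.sin (x * t) : ℂ))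
            Filter.atTop (nhds (fs x))) →
        -- H0T is the odd Hilbert transform (principal value) of T_{f'}(u) = f̂'_s(u)/u
        (∀ x : ℝ, 0 < x →
          Filter.Tendsto (fun δ : ℝ =>
              ((2 / Real.pi : ℝ) : ℂ) *
                ∫ t in {t : ℝ | 0 < t ∧ δ < |t - x|},
                  (t : ℂ) *
                      ((∫ u in Set.Ioi (0 : ℝ), f' u * (Real.sin (t * u) : ℂ)) / (t : ℂ)) /
                    ((t : ℂ) ^ 2 - (x : ℂ) ^ 2))
            (nhdsWithin 0 (Set.Ioi 0)) (nhds (H0T x))) →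
        -- f' belongs to Q₀ : ∫_0^∞ |f̂'_s(x)|/x dx < ∞
        (∫⁻ x in Set.Ioi (0 : ℝ),
          ENNReal.ofReal (‖∫ t in Set.Ioi (0 : ℝ), f' t * (Real.sin (x * t) : ℂ)‖ / x)) < ⊤ →
        -- H₀(T_{f'}) is Lebesgue integrable on (0,∞)
        MeasureTheory.IntegrableOn H0T (Set.Ioi 0) →
        ∃ G : ℝ → ℂ,
          (∀ x : ℝ, 0 < x →
            fs x = ((1 / x : ℝ) : ℂ) * f (Real.pi / (2 * x)) + G x) ∧
          MeasureTheory.IntegrableOn G (Set.Ioi 0) ∧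
          (∫ x in Set.Ioi (0 : ℝ), ‖G x‖) ≤
            C * ((∫ t in Set.Ioi (0 : ℝ), ‖f' t‖) + ∫ x in Set.Ioi (0 : ℝ), ‖H0T x‖) := by
  have hL := sineIntegralLimit_pos
  set L := sineIntegralLimit with hLdef
  set A := ∫ z in Ioi (0 : ℝ), |remainderKernel z / z| with hA
  have hA0 : 0 ≤ A := integral_nonneg fun _ => abs_nonneg _
  have hc : 0 < π / (2 * L) := by positivity
  refine ⟨A + π / (2 * L), by positivity, ?_⟩
  intro f g fs H0T hf _ hlim hg hfs hH _ hHint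
  have hfg (t : ℝ) (ht : 0 < t) := eq_neg_integral_Ioi_of_tendsto_zero hf hlim hg ht
  have hR := (integrable_mellin_convolution hg measurable_remainderKernel
    integrableOn_remainderKernel_div).1.integral_prod_left
  have hRle := integral_norm_mellin_convolution_le hg measurable_remainderKernel
    integrableOn_remainderKernel_div
  rw [← hA] at hRle
  have hH' : IntegrableOn (fun x => ((π / (2 * L) : ℝ) : ℂ) * H0T x) (Ioi 0) := hHint.const_mul _
  refine ⟨fun x => (∫ u in Ioi (0 : ℝ), g u * ((remainderKernel (u * x) / x : ℝ) : ℂ)) +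
    ((π / (2 * L) : ℝ) : ℂ) * H0T x, fun x hx => ?_, hR.add hH', ?_⟩
  · have hHx := tendsto_nhds_unique (hH x hx)
      ((tendsto_truncated_hilbert_transform hg hx).const_mul _)
    dsimp only
    rw [integral_remainderKernel_eq hg hx, hHx, sine_transform_eq hfg hg hx (hfs x hx),
      hfg _ (by positivity : 0 < π / (2 * x)), ← hLdef]
    have hconst : ((π / (2 * L) : ℝ) : ℂ) * ((2 / π : ℝ) : ℂ) = ((1 / L : ℝ) : ℂ) := by
      rw [← Complex.ofReal_mul]
      congr 1
      field_simp
    rw [← mul_assoc, hconst]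
    ring
  · calc _ ≤ ∫ x in Ioi (0 : ℝ),
          (‖∫ u in Ioi (0 : ℝ), g u * ((remainderKernel (u * x) / x : ℝ) : ℂ)‖ +
            π / (2 * L) * ‖H0T x‖) := by
          refine integral_mono (hR.add hH').norm (hR.norm.add (hHint.norm.const_mul _)) fun x => ?_
          refine (norm_add_le _ _).trans_eq ?_
          rw [norm_mul, Complex.norm_real, norm_of_nonneg hc.le]
      _ ≤ A * (∫ u in Ioi (0 : ℝ), ‖g u‖) + π / (2 * L) * ∫ x in Ioi (0 : ℝ), ‖H0T x‖ := by
          rw [integral_add hR.norm (hHint.norm.const_mul _), integral_const_mul]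
          gcongr
      _ ≤ _ := by
          have h1 : 0 ≤ ∫ u in Ioi (0 : ℝ), ‖g u‖ := integral_nonneg fun _ => norm_nonneg _
          have h2 : 0 ≤ ∫ x in Ioi (0 : ℝ), ‖H0T x‖ := integral_nonneg fun _ => norm_nonneg _
          nlinarith [mul_nonneg hA0 h2, mul_nonneg hc.le h1]
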